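/- Fix n ≥ 2, k ∈ (0,1), θ > 0, and let Y_1,…,Y_n be i.i.d. uniform on [θ(1−k), θ(1+k)]. For observations y let F(·; y) denote the cumulative distribution function of the fiducial distribution Pareto(n, [y_(n)/(1+k), y_(1)/(1−k)]). Then the fiducial distribution is an exact confidence distribution: under the law of Y with true parameter θ, the random variable C = F(θ; Y) is uniformly distributed on [0, 1]. In particular, for every γ ∈ (0,1), P_θ(F(θ; Y) ≤ γ) = γ. -/

import Mathlib

open MeasureTheory

/-- The uniform probability distribution on the interval `[a, b]`. -/
noncomputable def unifIcc (a b : ℝ) : Measure ℝ :=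
  (ENNReal.ofReal (b - a))⁻¹ • volume.restrict (Set.Icc a b)

/-- The truncated Pareto distribution `Pareto(α, [a,b])`: the measure on `ℝ` with density
`t ↦ (α/(a^(-α) - b^(-α))) t^(-α-1)` on `[a, b]` and `0` elsewhere. -/
noncomputable def paretoTrunc (α a b : ℝ) : Measure ℝ :=
  volume.withDensity fun t =>
    ENNReal.ofReal
      ((Set.Icc a b).indicator (fun t => α / (a ^ (-α) - b ^ (-α)) * t ^ (-α - 1)) t)

/-- `F(t; y)`: the CDF at `t` of the fiducial distribution
`Pareto(n, [y_(n)/(1+k), y_(1)/(1-k)])` given data `y`. -/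
noncomputable def fidCDF (n : ℕ) (k : ℝ) (y : Fin n → ℝ) (t : ℝ) : ℝ :=
  (paretoTrunc (n : ℝ) ((⨆ i, y i) / (1 + k)) ((⨅ i, y i) / (1 - k)) (Set.Iic t)).toReal

open Set

/-- The CDF at `t ∈ [a, b]` of the truncated Pareto distribution with integer shape `n`. -/
noncomputable def invPowRatio (n : ℕ) (a b t : ℝ) : ℝ :=
  ((a ^ n)⁻¹ - (t ^ n)⁻¹) / ((a ^ n)⁻¹ - (b ^ n)⁻¹)

lemma inv_pow_lt_inv_pow {n : ℕ} (hn : n ≠ 0) {a b : ℝ} (ha : 0 < a) (hab : a < b) :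
    (b ^ n)⁻¹ < (a ^ n)⁻¹ :=
  inv_strictAnti₀ (pow_pos ha n) (pow_lt_pow_left₀ hab ha.le hn)

lemma inv_pow_le_inv_pow (n : ℕ) {a b : ℝ} (ha : 0 < a) (hab : a ≤ b) :
    (b ^ n)⁻¹ ≤ (a ^ n)⁻¹ :=
  inv_anti₀ (pow_pos ha n) (pow_le_pow_left₀ ha.le hab n)

lemma invPowRatio_nonneg {n : ℕ} {a b t : ℝ} (ha : 0 < a) (hat : a ≤ t) (htb : t ≤ b) :
    0 ≤ invPowRatio n a b t :=
  div_nonneg (sub_nonneg.2 (inv_pow_le_inv_pow n ha hat))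
    (sub_nonneg.2 (inv_pow_le_inv_pow n ha (hat.trans htb)))

lemma invPowRatio_le_one {n : ℕ} {a b t : ℝ} (ha : 0 < a) (hat : a ≤ t) (htb : t ≤ b) :
    invPowRatio n a b t ≤ 1 := by
  refine div_le_one_of_le₀ ?_ (sub_nonneg.2 (inv_pow_le_inv_pow n ha (hat.trans htb)))
  linarith [inv_pow_le_inv_pow n (ha.trans_le hat) htb]

lemma invPowRatio_mul {n : ℕ} {s : ℝ} (hs : 0 < s) (a b t : ℝ) :
    invPowRatio n (s * a) (s * b) (s * t) = invPowRatio n a b t := by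
  have : (s ^ n)⁻¹ ≠ 0 := by positivity
  simp only [invPowRatio, mul_pow, mul_inv, ← mul_sub]
  exact mul_div_mul_left _ _ this

lemma lintegral_Icc_inv_pow {n : ℕ} (hn : n ≠ 0) {a b : ℝ} (ha : 0 < a) (hab : a ≤ b) :
    ∫⁻ t in Icc a b, ENNReal.ofReal (t ^ (n + 1))⁻¹ =
      ENNReal.ofReal (((a ^ n)⁻¹ - (b ^ n)⁻¹) / n) := by
  have hcont : ContinuousOn (fun t : ℝ => (t ^ (n + 1))⁻¹) (Icc a b) :=
    (continuousOn_id.pow _).inv₀ fun t ht => (pow_pos (ha.trans_le ht.1) _).ne'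
  rw [← ofReal_integral_eq_lintegral_ofReal (hcont.integrableOn_Icc)]
  · congr 1
    rw [integral_Icc_eq_integral_Ioc, ← intervalIntegral.integral_of_le hab,
      intervalIntegral.integral_eq_sub_of_hasDerivAt (f := fun t => -(t ^ n)⁻¹ / n)]
    · ring
    · intro t ht
      rw [uIcc_of_le hab] at ht
      have ht0 : t ≠ 0 := (ha.trans_le ht.1).ne'
      have hn' : (n : ℝ) ≠ 0 := by exact_mod_cast hn
      have hderiv : HasDerivAt (fun t : ℝ => -(t ^ n)⁻¹ / n) _ t :=
        ((hasDerivAt_pow n t).inv (pow_ne_zero n ht0)).neg.div_const (n : ℝ)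
      refine hderiv.congr_deriv ?_
      obtain ⟨m, rfl⟩ := Nat.exists_eq_succ_of_ne_zero hn
      simp only [Nat.succ_eq_add_one, Nat.add_sub_cancel] at hn' ⊢
      field_simp
      ring
    · exact (uIcc_of_le hab ▸ hcont).intervalIntegrable
  · filter_upwards [ae_restrict_mem measurableSet_Icc] with t ht
    have := ha.trans_le ht.1
    positivity

lemma lintegral_invPowRatio_le {n : ℕ} (hn : n ≠ 0) {a b γ : ℝ} (ha : 0 < a) (hab : a ≤ b)
    (hγ : γ ∈ Icc (0 : ℝ) 1) :
    ∫⁻ t in {t | a ≤ t ∧ t ≤ b ∧ invPowRatio n a b t ≤ γ}, ENNReal.ofReal (t ^ (n + 1))⁻¹ =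
      ENNReal.ofReal γ * ENNReal.ofReal (((a ^ n)⁻¹ - (b ^ n)⁻¹) / n) := by
  rcases hab.eq_or_lt with rfl | hlt
  · have : volume {t : ℝ | a ≤ t ∧ t ≤ a ∧ invPowRatio n a a t ≤ γ} = 0 :=
      measure_mono_null (t := {a}) (fun t ht => le_antisymm ht.2.1 ht.1) (by simp)
    rw [setLIntegral_measure_zero _ _ this]
    simp
  have hpos := sub_pos.2 (inv_pow_lt_inv_pow hn ha hlt)
  have hcont : ContinuousOn (fun t : ℝ => (t ^ n)⁻¹) (Icc a b) :=
    (continuousOn_id.pow _).inv₀ fun t ht => (pow_pos (ha.trans_le ht.1) _).ne'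
  obtain ⟨c, hc, hce⟩ : (a ^ n)⁻¹ - γ * ((a ^ n)⁻¹ - (b ^ n)⁻¹) ∈
      (fun t : ℝ => (t ^ n)⁻¹) '' Icc a b :=
    intermediate_value_Icc' hab hcont ⟨by nlinarith [hγ.2], by nlinarith [hγ.1]⟩
  simp only at hce
  have hset : {t | a ≤ t ∧ t ≤ b ∧ invPowRatio n a b t ≤ γ} = Icc a c := by
    ext t
    simp only [mem_ofPred_eq, mem_Icc, invPowRatio, div_le_iff₀ hpos]
    constructor
    · rintro ⟨h1, -, h3⟩
      refine ⟨h1, not_lt.1 fun h => ?_⟩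
      linarith [inv_pow_lt_inv_pow hn (ha.trans_le hc.1) h]
    · rintro ⟨h1, h2⟩
      refine ⟨h1, h2.trans hc.2, ?_⟩
      linarith [inv_pow_le_inv_pow n (ha.trans_le h1) h2]
  rw [hset, lintegral_Icc_inv_pow hn ha hc.1, hce, ← ENNReal.ofReal_mul hγ.1]
  congr 1
  ring

lemma lintegral_Icc_inv {a b : ℝ} (ha : 0 < a) (hab : a ≤ b) :
    ∫⁻ t in Icc a b, ENNReal.ofReal t⁻¹ = ENNReal.ofReal (Real.log (b / a)) := by
  have hcont : ContinuousOn (fun t : ℝ => t⁻¹) (Icc a b) :=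
    continuousOn_id.inv₀ fun t ht => (ha.trans_le ht.1).ne'
  rw [← ofReal_integral_eq_lintegral_ofReal hcont.integrableOn_Icc]
  · rw [integral_Icc_eq_integral_Ioc, ← intervalIntegral.integral_of_le hab,
      integral_inv_of_pos ha (ha.trans_le hab)]
  · filter_upwards [ae_restrict_mem measurableSet_Icc] with t ht
    exact inv_nonneg.2 (ha.le.trans ht.1)

lemma paretoTrunc_Iic {n : ℕ} (hn : n ≠ 0) {a b t : ℝ} (ha : 0 < a) (hat : a ≤ t) (htb : t ≤ b) :
    paretoTrunc n a b (Iic t) = ENNReal.ofReal (invPowRatio n a b t) := by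
  have hn' : (n : ℝ) ≠ 0 := by exact_mod_cast hn
  have hb := ha.trans_le (hat.trans htb)
  have hc : 0 ≤ n / ((a ^ n)⁻¹ - (b ^ n)⁻¹) :=
    div_nonneg n.cast_nonneg (sub_nonneg.2 (inv_pow_le_inv_pow n ha (hat.trans htb)))
  rw [paretoTrunc, withDensity_apply _ measurableSet_Iic]
  have h1 : ∀ s : ℝ, ENNReal.ofReal ((Icc a b).indicator
      (fun t => (n : ℝ) / (a ^ (-(n : ℝ)) - b ^ (-(n : ℝ))) * t ^ (-(n : ℝ) - 1)) s) =
      (Icc a b).indicator (fun s => ENNReal.ofReal (n / ((a ^ n)⁻¹ - (b ^ n)⁻¹)) *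
        ENNReal.ofReal (s ^ (n + 1))⁻¹) s := by
    intro s
    by_cases hs : s ∈ Icc a b
    · have hs0 : 0 < s := ha.trans_le hs.1
      have e : -(n : ℝ) - 1 = -((n + 1 : ℕ) : ℝ) := by push_cast; ring
      rw [indicator_of_mem hs, indicator_of_mem hs, ← ENNReal.ofReal_mul hc, e,
        Real.rpow_neg ha.le, Real.rpow_neg hb.le, Real.rpow_neg hs0.le]
      simp only [Real.rpow_natCast]
    · simp [indicator_of_notMem hs]
  simp_rw [h1]
  rw [lintegral_indicator measurableSet_Icc, Measure.restrict_restrict measurableSet_Icc]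
  have hset : Icc a b ∩ Iic t = Icc a t := by
    ext s
    simp only [mem_inter_iff, mem_Icc, mem_Iic]
    exact ⟨fun h => ⟨h.1.1, h.2⟩, fun h => ⟨⟨h.1, h.2.trans htb⟩, h.2⟩⟩
  rw [hset, lintegral_const_mul _ (by fun_prop), lintegral_Icc_inv_pow hn ha hat,
    ← ENNReal.ofReal_mul hc, invPowRatio]
  congr 1
  field_simp

/-- The data for which `t` lies in the support of the fiducial distribution and the fiducial CDF
at `t` is at most `γ`. -/
def fidRegion (n : ℕ) (k γ t : ℝ) : Set (Fin n → ℝ) :=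
  {y | t * (1 - k) ≤ ⨅ i, y i ∧ ⨆ i, y i ≤ t * (1 + k) ∧
    invPowRatio n ((⨆ i, y i) / (1 + k)) ((⨅ i, y i) / (1 - k)) t ≤ γ}

lemma measurableSet_fidRegion_prod (n : ℕ) (k γ : ℝ) :
    MeasurableSet {p : ℝ × (Fin n → ℝ) | p.2 ∈ fidRegion n k γ p.1} := by
  simp only [fidRegion, invPowRatio, mem_ofPred_eq]
  simp only [ofPred_and]
  exact (measurableSet_le (by fun_prop) (by fun_prop)).inter
    ((measurableSet_le (by fun_prop) (by fun_prop)).inter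
      (measurableSet_le (by fun_prop) (by fun_prop)))

lemma measurableSet_fidRegion (n : ℕ) (k γ t : ℝ) : MeasurableSet (fidRegion n k γ t) :=
  (measurableSet_fidRegion_prod n k γ).preimage (measurable_prodMk_left (x := t))

lemma smul_mem_fidRegion_iff {n : ℕ} {k γ s t : ℝ} (hs : 0 < s) (y : Fin n → ℝ) :
    s • y ∈ fidRegion n k γ (s * t) ↔ y ∈ fidRegion n k γ t := by
  simp only [fidRegion, mem_ofPred_eq, Pi.smul_apply, smul_eq_mul,
    ← Real.mul_iSup_of_nonneg hs.le, ← Real.mul_iInf_of_nonneg hs.le, mul_div_assoc,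
    invPowRatio_mul hs, mul_assoc, mul_le_mul_iff_right₀ hs]

lemma volume_eq_mul_volume_preimage_smul {n : ℕ} {s : ℝ} (hs : 0 < s) (A : Set (Fin n → ℝ)) :
    volume A = ENNReal.ofReal (s ^ n) * volume ((fun y : Fin n → ℝ => s • y) ⁻¹' A) := by
  rw [Measure.addHaar_preimage_smul _ hs.ne', ← mul_assoc, ← ENNReal.ofReal_mul (by positivity)]
  have : 0 < s ^ n := by positivity
  simp [abs_of_pos this, this.ne']

lemma volume_fidRegion_scale {n : ℕ} {k γ s : ℝ} (hs : 0 < s) :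
    volume (fidRegion n k γ s) = ENNReal.ofReal (s ^ n) * volume (fidRegion n k γ 1) := by
  rw [volume_eq_mul_volume_preimage_smul hs]
  congr 2
  ext y
  simpa using smul_mem_fidRegion_iff (t := 1) hs y

lemma volume_fidRegion_inter_scale {n : ℕ} {k γ s : ℝ} (hs : 0 < s) :
    volume (fidRegion n k γ s ∩ {y | ⨆ i, y i ∈ Icc (1 : ℝ) 2}) =
      ENNReal.ofReal (s ^ n) *
        volume (fidRegion n k γ 1 ∩ {y | s * ⨆ i, y i ∈ Icc (1 : ℝ) 2}) := by
  rw [volume_eq_mul_volume_preimage_smul hs]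
  congr 2
  ext y
  have := smul_mem_fidRegion_iff (k := k) (γ := γ) (t := 1) hs y
  rw [mul_one] at this
  simp only [mem_preimage, mem_inter_iff, this, mem_ofPred_eq, Pi.smul_apply, smul_eq_mul,
    ← Real.mul_iSup_of_nonneg hs.le]

lemma lintegral_volume_fidRegion {n : ℕ} (hn : n ≠ 0) {k γ : ℝ} (hk : k < 1) :
    ∫⁻ t in Ioi (0 : ℝ), ENNReal.ofReal (t ^ (n + 1))⁻¹ *
        volume (fidRegion n k γ t ∩ {y | ⨆ i, y i ∈ Icc (1 : ℝ) 2}) =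
      ENNReal.ofReal (Real.log 2) * volume (fidRegion n k γ 1) := by
  have hne : Nonempty (Fin n) := Fin.pos_iff_nonempty.1 (Nat.pos_of_ne_zero hn)
  have hS : MeasurableSet {p : ℝ × (Fin n → ℝ) | p.1 * ⨆ i, p.2 i ∈ Icc (1 : ℝ) 2} :=
    measurableSet_Icc.preimage (f := fun p : ℝ × (Fin n → ℝ) => p.1 * ⨆ i, p.2 i) (by fun_prop)
  calc
    _ = ∫⁻ t in Ioi (0 : ℝ), ∫⁻ y in fidRegion n k γ 1,
          {p : ℝ × (Fin n → ℝ) | p.1 * ⨆ i, p.2 i ∈ Icc (1 : ℝ) 2}.indicator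
            (fun p => ENNReal.ofReal p.1⁻¹) (t, y) := by
      refine setLIntegral_congr_fun measurableSet_Ioi fun t ht => ?_
      have ht : 0 < t := ht
      have hSt : MeasurableSet {y : Fin n → ℝ | t * ⨆ i, y i ∈ Icc (1 : ℝ) 2} :=
        hS.preimage (measurable_prodMk_left (x := t))
      have h1 : ∀ y : Fin n → ℝ, {p : ℝ × (Fin n → ℝ) | p.1 * ⨆ i, p.2 i ∈ Icc (1 : ℝ) 2}.indicator
            (fun p => ENNReal.ofReal p.1⁻¹) (t, y) =
          {y : Fin n → ℝ | t * ⨆ i, y i ∈ Icc (1 : ℝ) 2}.indicator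
            (fun _ => ENNReal.ofReal t⁻¹) y := fun y => rfl
      simp_rw [h1]
      rw [lintegral_indicator_const hSt, Measure.restrict_apply hSt,
        volume_fidRegion_inter_scale ht, ← mul_assoc, ← ENNReal.ofReal_mul (by positivity),
        inter_comm]
      congr 2
      field_simp
      ring
    _ = ∫⁻ y in fidRegion n k γ 1, ∫⁻ t in Ioi (0 : ℝ),
          {p : ℝ × (Fin n → ℝ) | p.1 * ⨆ i, p.2 i ∈ Icc (1 : ℝ) 2}.indicator
            (fun p => ENNReal.ofReal p.1⁻¹) (t, y) :=
      lintegral_lintegral_swap (Measurable.indicator (by fun_prop) hS).aemeasurable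
    _ = ∫⁻ y in fidRegion n k γ 1, ENNReal.ofReal (Real.log 2) := by
      refine setLIntegral_congr_fun (measurableSet_fidRegion n k γ 1) fun y hy => ?_
      have hM : 0 < ⨆ i, y i := by
        refine lt_of_lt_of_le ?_ (hy.1.trans (ciInf_le_ciSup (finite_range y).bddBelow
          (finite_range y).bddAbove))
        linarith
      have h1 : ∀ t : ℝ, {p : ℝ × (Fin n → ℝ) | p.1 * ⨆ i, p.2 i ∈ Icc (1 : ℝ) 2}.indicator
            (fun p => ENNReal.ofReal p.1⁻¹) (t, y) =
          (Icc (1 / ⨆ i, y i) (2 / ⨆ i, y i)).indicator (fun t => ENNReal.ofReal t⁻¹) t := by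
        intro t
        refine indicator_eq_indicator ?_ rfl
        simp only [mem_ofPred_eq, mem_Icc, div_le_iff₀ hM, le_div_iff₀ hM]
      simp_rw [h1]
      have hsub : Icc (1 / ⨆ i, y i) (2 / ⨆ i, y i) ∩ Ioi 0 =
          Icc (1 / ⨆ i, y i) (2 / ⨆ i, y i) :=
        inter_eq_left.2 fun t ht => lt_of_lt_of_le (by positivity) ht.1
      rw [lintegral_indicator measurableSet_Icc, Measure.restrict_restrict measurableSet_Icc, hsub,
        lintegral_Icc_inv (by positivity) (by gcongr; norm_num)]
      congr 2
      field_simp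
    _ = _ := by rw [setLIntegral_const]

lemma lintegral_volume_fidRegion_eq_mul {n : ℕ} (hn : n ≠ 0) {k γ : ℝ} (hk : k ∈ Ioo (0 : ℝ) 1)
    (hγ : γ ∈ Icc (0 : ℝ) 1) :
    ∫⁻ t in Ioi (0 : ℝ), ENNReal.ofReal (t ^ (n + 1))⁻¹ *
        volume (fidRegion n k γ t ∩ {y | ⨆ i, y i ∈ Icc (1 : ℝ) 2}) =
      ENNReal.ofReal γ * ∫⁻ y : Fin n → ℝ in {y | ⨆ i, y i ∈ Icc (1 : ℝ) 2},
        ENNReal.ofReal (((((⨆ i, y i) / (1 + k)) ^ n)⁻¹ - (((⨅ i, y i) / (1 - k)) ^ n)⁻¹) / n) *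
          {y : Fin n → ℝ | (⨆ i, y i) / (1 + k) ≤ (⨅ i, y i) / (1 - k)}.indicator 1 y := by
  have hk1 : 0 < 1 + k := by linarith [hk.1]
  have hk2 : 0 < 1 - k := by linarith [hk.2]
  have hS : MeasurableSet {y : Fin n → ℝ | ⨆ i, y i ∈ Icc (1 : ℝ) 2} :=
    measurableSet_Icc.preimage (f := fun y : Fin n → ℝ => ⨆ i, y i) (by fun_prop)
  have hR := measurableSet_fidRegion_prod n k γ
  calc
    _ = ∫⁻ t in Ioi (0 : ℝ), ∫⁻ y in {y : Fin n → ℝ | ⨆ i, y i ∈ Icc (1 : ℝ) 2},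
          {p : ℝ × (Fin n → ℝ) | p.2 ∈ fidRegion n k γ p.1}.indicator
            (fun p => ENNReal.ofReal (p.1 ^ (n + 1))⁻¹) (t, y) := by
      refine lintegral_congr fun t => ?_
      have h1 : ∀ y : Fin n → ℝ, {p : ℝ × (Fin n → ℝ) | p.2 ∈ fidRegion n k γ p.1}.indicator
            (fun p => ENNReal.ofReal (p.1 ^ (n + 1))⁻¹) (t, y) =
          (fidRegion n k γ t).indicator (fun _ => ENNReal.ofReal (t ^ (n + 1))⁻¹) y :=
        fun y => rfl
      simp_rw [h1]
      rw [lintegral_indicator_const (measurableSet_fidRegion n k γ t),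
        Measure.restrict_apply (measurableSet_fidRegion n k γ t)]
    _ = ∫⁻ y in {y : Fin n → ℝ | ⨆ i, y i ∈ Icc (1 : ℝ) 2}, ∫⁻ t in Ioi (0 : ℝ),
          {p : ℝ × (Fin n → ℝ) | p.2 ∈ fidRegion n k γ p.1}.indicator
            (fun p => ENNReal.ofReal (p.1 ^ (n + 1))⁻¹) (t, y) :=
      lintegral_lintegral_swap (Measurable.indicator (by fun_prop) hR).aemeasurable
    _ = _ := by
      rw [← lintegral_const_mul' _ _ ENNReal.ofReal_ne_top]
      refine setLIntegral_congr_fun hS fun y hy => ?_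
      have hM : 0 < ⨆ i, y i := zero_lt_one.trans_le hy.1
      have ha : 0 < (⨆ i, y i) / (1 + k) := by positivity
      have hset : MeasurableSet {t : ℝ | (⨆ i, y i) / (1 + k) ≤ t ∧ t ≤ (⨅ i, y i) / (1 - k) ∧
          invPowRatio n ((⨆ i, y i) / (1 + k)) ((⨅ i, y i) / (1 - k)) t ≤ γ} := by
        simp only [invPowRatio, ofPred_and]
        exact (measurableSet_le (by fun_prop) (by fun_prop)).inter
          ((measurableSet_le (by fun_prop) (by fun_prop)).inter
            (measurableSet_le (by fun_prop) (by fun_prop)))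
      have h1 : ∀ t : ℝ, {p : ℝ × (Fin n → ℝ) | p.2 ∈ fidRegion n k γ p.1}.indicator
            (fun p => ENNReal.ofReal (p.1 ^ (n + 1))⁻¹) (t, y) =
          {t : ℝ | (⨆ i, y i) / (1 + k) ≤ t ∧ t ≤ (⨅ i, y i) / (1 - k) ∧
            invPowRatio n ((⨆ i, y i) / (1 + k)) ((⨅ i, y i) / (1 - k)) t ≤ γ}.indicator
            (fun t => ENNReal.ofReal (t ^ (n + 1))⁻¹) t := by
        intro t
        refine indicator_eq_indicator ?_ rfl
        simp only [mem_ofPred_eq, fidRegion, div_le_iff₀ hk1, le_div_iff₀ hk2]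
        tauto
      simp_rw [h1]
      rw [lintegral_indicator hset, Measure.restrict_restrict hset,
        inter_eq_left.2 (fun t ht => mem_Ioi.2 (ha.trans_le ht.1))]
      by_cases hab : (⨆ i, y i) / (1 + k) ≤ (⨅ i, y i) / (1 - k)
      · rw [lintegral_invPowRatio_le hn ha hab hγ, indicator_of_mem (by exact hab)]
        simp
      · rw [indicator_of_notMem (by exact hab)]
        have : {t : ℝ | (⨆ i, y i) / (1 + k) ≤ t ∧ t ≤ (⨅ i, y i) / (1 - k) ∧
            invPowRatio n ((⨆ i, y i) / (1 + k)) ((⨅ i, y i) / (1 - k)) t ≤ γ} = ∅ :=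
          eq_empty_of_forall_notMem fun t ht => hab (ht.1.trans ht.2.1)
        simp [this]

lemma volume_fidRegion {n : ℕ} (hn : n ≠ 0) {k γ t : ℝ} (hk : k ∈ Ioo (0 : ℝ) 1)
    (hγ : γ ∈ Icc (0 : ℝ) 1) (ht : 0 < t) :
    volume (fidRegion n k γ t) = ENNReal.ofReal γ * volume (fidRegion n k 1 t) := by
  have hlog : ENNReal.ofReal (Real.log 2) ≠ 0 := by
    simpa using Real.log_pos one_lt_two
  have h1 := lintegral_volume_fidRegion_eq_mul hn hk (γ := 1) (by simp)
  have hγ' := lintegral_volume_fidRegion_eq_mul hn hk hγ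
  rw [ENNReal.ofReal_one, one_mul] at h1
  rw [← h1, lintegral_volume_fidRegion hn hk.2, lintegral_volume_fidRegion hn hk.2,
    mul_left_comm] at hγ'
  rw [volume_fidRegion_scale ht, volume_fidRegion_scale (γ := 1) ht,
    (ENNReal.mul_right_inj hlog ENNReal.ofReal_ne_top).1 hγ', mul_left_comm]

instance isProbabilityMeasure_unifIcc {a b : ℝ} [Fact (a < b)] :
    IsProbabilityMeasure (unifIcc a b) := by
  have hab : 0 < b - a := sub_pos.2 Fact.out
  refine ⟨?_⟩
  rw [unifIcc, Measure.smul_apply, Measure.restrict_apply_univ, Real.volume_Icc, smul_eq_mul,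
    ENNReal.inv_mul_cancel (by simpa using hab) ENNReal.ofReal_ne_top]

lemma pi_unifIcc (n : ℕ) {a b : ℝ} (hab : a < b) :
    (Measure.pi fun _ : Fin n => unifIcc a b) =
      ((ENNReal.ofReal (b - a))⁻¹) ^ n •
        (volume : Measure (Fin n → ℝ)).restrict (univ.pi fun _ => Icc a b) := by
  have : Fact (a < b) := ⟨hab⟩
  refine Measure.pi_eq fun s hs => ?_
  rw [Measure.smul_apply, volume_pi, Measure.restrict_pi_pi, Measure.pi_pi]
  simp [unifIcc, Finset.prod_mul_distrib]

lemma mem_pi_Icc_iff {n : ℕ} (hn : n ≠ 0) {a b : ℝ} (y : Fin n → ℝ) :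
    y ∈ univ.pi (fun _ : Fin n => Icc a b) ↔ a ≤ ⨅ i, y i ∧ ⨆ i, y i ≤ b := by
  have hne : Nonempty (Fin n) := Fin.pos_iff_nonempty.1 (Nat.pos_of_ne_zero hn)
  rw [le_ciInf_iff (finite_range y).bddBelow, ciSup_le_iff (finite_range y).bddAbove,
    ← forall_and]
  simp only [mem_univ_pi, mem_Icc]

lemma fidCDF_eq {n : ℕ} (hn : n ≠ 0) {k θ : ℝ} (hk : k ∈ Ioo (0 : ℝ) 1) (hθ : 0 < θ)
    {y : Fin n → ℝ} (hy : y ∈ univ.pi fun _ : Fin n => Icc (θ * (1 - k)) (θ * (1 + k))) :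
    fidCDF n k y θ = invPowRatio n ((⨆ i, y i) / (1 + k)) ((⨅ i, y i) / (1 - k)) θ ∧
      fidCDF n k y θ ∈ Icc (0 : ℝ) 1 := by
  have hne : Nonempty (Fin n) := Fin.pos_iff_nonempty.1 (Nat.pos_of_ne_zero hn)
  have hk1 : 0 < 1 + k := by linarith [hk.1]
  have hk2 : 0 < 1 - k := by linarith [hk.2]
  rw [mem_pi_Icc_iff hn] at hy
  have hM : 0 < ⨆ i, y i :=
    (mul_pos hθ hk2).trans_le (hy.1.trans (ciInf_le_ciSup (finite_range y).bddBelow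
      (finite_range y).bddAbove))
  have ha : 0 < (⨆ i, y i) / (1 + k) := by positivity
  have hat := (div_le_iff₀ hk1).2 hy.2
  have htb := (le_div_iff₀ hk2).2 hy.1
  have h0 := invPowRatio_nonneg (n := n) ha hat htb
  have h : fidCDF n k y θ = invPowRatio n ((⨆ i, y i) / (1 + k)) ((⨅ i, y i) / (1 - k)) θ := by
    rw [fidCDF, paretoTrunc_Iic hn ha hat htb, ENNReal.toReal_ofReal h0]
  exact ⟨h, h ▸ ⟨h0, invPowRatio_le_one ha hat htb⟩⟩

lemma fidRegion_eq {n : ℕ} (hn : n ≠ 0) {k θ : ℝ} (hk : k ∈ Ioo (0 : ℝ) 1) (hθ : 0 < θ) (γ : ℝ) :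
    fidRegion n k γ θ = {y | fidCDF n k y θ ≤ γ} ∩
      univ.pi fun _ : Fin n => Icc (θ * (1 - k)) (θ * (1 + k)) := by
  ext y
  by_cases hy : y ∈ univ.pi fun _ : Fin n => Icc (θ * (1 - k)) (θ * (1 + k))
  · have hy' := (mem_pi_Icc_iff hn y).1 hy
    simp only [fidRegion, mem_ofPred_eq, mem_inter_iff, hy, hy', true_and, and_true,
      (fidCDF_eq hn hk hθ hy).1]
  · have hy' := mt (mem_pi_Icc_iff hn y).2 hy
    simp only [fidRegion, mem_ofPred_eq, mem_inter_iff, hy, and_false, iff_false]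
    exact fun h => hy' ⟨h.1, h.2.1⟩

lemma pi_unifIcc_fidCDF_le {n : ℕ} (hn : n ≠ 0) {k θ γ : ℝ} (hk : k ∈ Ioo (0 : ℝ) 1) (hθ : 0 < θ)
    (hγ : γ ∈ Icc (0 : ℝ) 1) :
    (Measure.pi fun _ : Fin n => unifIcc (θ * (1 - k)) (θ * (1 + k)))
      {y : Fin n → ℝ | fidCDF n k y θ ≤ γ} = ENNReal.ofReal γ := by
  have hlt : θ * (1 - k) < θ * (1 + k) := by nlinarith [hk.1]
  have : Fact (θ * (1 - k) < θ * (1 + k)) := ⟨hlt⟩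
  have hcube : MeasurableSet (univ.pi fun _ : Fin n => Icc (θ * (1 - k)) (θ * (1 + k))) :=
    MeasurableSet.univ_pi fun _ => measurableSet_Icc
  have hfull : fidRegion n k 1 θ = univ.pi fun _ : Fin n => Icc (θ * (1 - k)) (θ * (1 + k)) := by
    rw [fidRegion_eq hn hk hθ, inter_eq_right]
    exact fun y hy => (fidCDF_eq hn hk hθ hy).2.2
  have huniv := measure_univ
    (μ := Measure.pi fun _ : Fin n => unifIcc (θ * (1 - k)) (θ * (1 + k)))
  rw [pi_unifIcc n hlt, Measure.smul_apply, Measure.restrict_apply_univ, smul_eq_mul] at huniv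
  rw [pi_unifIcc n hlt, Measure.smul_apply, Measure.restrict_apply' hcube,
    ← fidRegion_eq hn hk hθ, volume_fidRegion hn hk hγ hθ, hfull, smul_eq_mul, mul_left_comm,
    huniv, mul_one]

lemma aemeasurable_fidCDF {n : ℕ} (hn : n ≠ 0) {k θ : ℝ} (hk : k ∈ Ioo (0 : ℝ) 1) (hθ : 0 < θ) :
    AEMeasurable (fun y : Fin n → ℝ => fidCDF n k y θ)
      (Measure.pi fun _ : Fin n => unifIcc (θ * (1 - k)) (θ * (1 + k))) := by
  rw [pi_unifIcc n (by nlinarith [hk.1])]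
  refine AEMeasurable.smul_measure ⟨fun y =>
    invPowRatio n ((⨆ i, y i) / (1 + k)) ((⨅ i, y i) / (1 - k)) θ, ?_, ?_⟩ _
  · simp only [invPowRatio]
    fun_prop
  · filter_upwards [ae_restrict_mem (MeasurableSet.univ_pi fun _ => measurableSet_Icc)] with y hy
    exact (fidCDF_eq hn hk hθ hy).1

lemma unifIcc_zero_one_Iic {γ : ℝ} :
    unifIcc 0 1 (Iic γ) = ENNReal.ofReal (min 1 γ) := by
  rw [unifIcc, Measure.smul_apply, Measure.restrict_apply measurableSet_Iic, inter_comm]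
  have : Icc (0 : ℝ) 1 ∩ Iic γ = Icc 0 (min 1 γ) := by
    ext; simp [and_assoc]
  rw [this]
  simp

/-- The fiducial distribution is an exact confidence distribution: under
i.i.d. sampling `Y` from `Uniform[θ(1-k), θ(1+k)]`, the random variable `F(θ; Y)` is
uniformly distributed on `[0,1]`; in particular `P_θ(F(θ; Y) ≤ γ) = γ` for `γ ∈ (0,1)`. -/
theorem stmt_19 (n : ℕ) (hn : 2 ≤ n) (k : ℝ) (hk : k ∈ Set.Ioo (0:ℝ) 1)
    (θ : ℝ) (hθ : 0 < θ) :
    Measure.map (fun y : Fin n → ℝ => fidCDF n k y θ)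
        (Measure.pi fun _ : Fin n => unifIcc (θ * (1 - k)) (θ * (1 + k)))
      = unifIcc 0 1 ∧
    ∀ γ : ℝ, γ ∈ Set.Ioo (0:ℝ) 1 →
      (Measure.pi fun _ : Fin n => unifIcc (θ * (1 - k)) (θ * (1 + k)))
          {y : Fin n → ℝ | fidCDF n k y θ ≤ γ} = ENNReal.ofReal γ := by
  have hn0 : n ≠ 0 := by omega
  refine ⟨?_, fun γ hγ => pi_unifIcc_fidCDF_le hn0 hk hθ ⟨hγ.1.le, hγ.2.le⟩⟩
  have : Fact (θ * (1 - k) < θ * (1 + k)) := ⟨by nlinarith [hk.1]⟩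
  have : Fact ((0 : ℝ) < 1) := ⟨one_pos⟩
  have hmeas := aemeasurable_fidCDF hn0 hk hθ
  have := Measure.isProbabilityMeasure_map hmeas
  refine Measure.ext_of_Iic _ _ fun γ => ?_
  rw [Measure.map_apply_of_aemeasurable hmeas measurableSet_Iic, unifIcc_zero_one_Iic]
  change (Measure.pi fun _ : Fin n => unifIcc (θ * (1 - k)) (θ * (1 + k)))
    {y : Fin n → ℝ | fidCDF n k y θ ≤ γ} = _
  rcases le_total γ 0 with h0 | h0
  · rw [ENNReal.ofReal_of_nonpos ((min_le_right _ _).trans h0), ← nonpos_iff_eq_zero,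
      ← ENNReal.ofReal_zero, ← pi_unifIcc_fidCDF_le hn0 hk hθ (γ := 0) (by simp)]
    exact measure_mono fun y hy => le_trans hy h0
  rcases le_total γ 1 with h1 | h1
  · rw [min_eq_right h1, pi_unifIcc_fidCDF_le hn0 hk hθ ⟨h0, h1⟩]
  · rw [min_eq_left h1, ENNReal.ofReal_one]
    refine le_antisymm prob_le_one ?_
    rw [← ENNReal.ofReal_one, ← pi_unifIcc_fidCDF_le hn0 hk hθ (γ := 1) (by simp)]
    exact measure_mono fun y hy => le_trans hy h1
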